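/- arXiv:2003.02296 — 8 statements merged into one kernel-verified Lean document; each statement's English description precedes it below -/
import Mathlib

section
/- Discrete conservation and total energy balance of the split form ALE DGSEM. Under the DGSEM setup (with no assumptions on the fluxes beyond the stated symmetry and consistency), the semi-discrete split form ALE DGSEM is discretely conservative: for all τ, d/dτ Σ_{i,j,k} ω_i ω_j ω_k (𝒥U)_ijk = −∮_{∂E,N} G̃*_n̂ dS, as an identity in ℝ⁵. In particular its fifth component gives the discrete total energy balance d/dτ ⟨U⁵, 𝒥⟩_N = −Σ_{ι=1,2,3} ∮_{∂E,N} ŝn_ι · G_ι^{5,*} dS, where G_ι^{5,*} denotes the fifth component of the Cartesian surface flux G_ι^*. -/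
noncomputable section

namespace DGSEM

/-- a node `(i,j,k)` of the reference element, as a map from the three coordinate
directions to indices in `{0,…,N}`. -/
abbrev Node (N : ℕ) := Fin 3 → Fin (N + 1)

variable {N : ℕ}

/-- nodal quadrature weight `ω_i ω_j ω_k`. -/
def nodeWeight (ω : Fin (N + 1) → ℝ) (n : Node N) : ℝ := ∏ d, ω (n d)

/-- product of the two tangential quadrature weights on a face normal to direction
`β`. -/
def tangWeight (ω : Fin (N + 1) → ℝ) (β : Fin 3) (n : Node N) : ℝ :=
  ∏ d ∈ Finset.univ.erase β, ω (n d)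

/-- face index: `N` on the upper face (`s = true`), `0` on the lower face. -/
def faceIdx (N : ℕ) (s : Bool) : Fin (N + 1) := if s then Fin.last N else 0

/-- outward sign `σ` of a face: `+1` on the upper face, `−1` on the lower face. -/
def faceSign (s : Bool) : ℝ := if s then 1 else -1

/-- nodal derivative operator `∂_ιᴰ`: `(∂₁ᴰ g)_ijk = Σ_m D_im g_mjk` etc. -/
def dD (D : Matrix (Fin (N + 1)) (Fin (N + 1)) ℝ) (ι : Fin 3) (g : Node N → ℝ)
    (n : Node N) : ℝ :=
  ∑ m, D (n ι) m * g (Function.update n ι m)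

/-- density `ρ = U¹` of a state `W ∈ ℝ⁵`. -/
def dens (W : Fin 5 → ℝ) : ℝ := W 0

/-- velocity `u⃗ = (U²,U³,U⁴)/ρ` of a state. -/
def vel (W : Fin 5 → ℝ) (d : Fin 3) : ℝ := W d.succ.castSucc / W 0

/-- kinetic energy `𝕜 = ½ρ|u⃗|²` of a state. -/
def kin (W : Fin 5 → ℝ) : ℝ := 1 / 2 * W 0 * ∑ d, vel W d ^ 2

/-- pressure `p = (γ−1)(U⁵ − ½ρ|u⃗|²)` of a state. -/
def pres (γ : ℝ) (W : Fin 5 → ℝ) : ℝ := (γ - 1) * (W 4 - kin W)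

/-- Cartesian Euler flux `F_ι(U)`. -/
def eulerFlux (γ : ℝ) (ι : Fin 3) (W : Fin 5 → ℝ) : Fin 5 → ℝ :=
  ![dens W * vel W ι,
    dens W * vel W ι * vel W 0 + (if ι = 0 then pres γ W else 0),
    dens W * vel W ι * vel W 1 + (if ι = 1 then pres γ W else 0),
    dens W * vel W ι * vel W 2 + (if ι = 2 then pres γ W else 0),
    vel W ι * (W 4 + pres γ W)]

/-- derivative projection operator `(𝔻_N·G̃^#)_ijk` built from a two-point volume flux
`Gs`, grid velocities `ν`, metric terms `Ja` and the nodal states `U`. -/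
def Dproj (D : Matrix (Fin (N + 1)) (Fin (N + 1)) ℝ)
    (Gs : Fin 3 → (Fin 3 → ℝ) → (Fin 3 → ℝ) → (Fin 5 → ℝ) → (Fin 5 → ℝ) → Fin 5 → ℝ)
    (ν : Node N → Fin 3 → ℝ) (Ja : Fin 3 → Node N → Fin 3 → ℝ)
    (U : Node N → Fin 5 → ℝ) (n : Node N) (c : Fin 5) : ℝ :=
  ∑ ι : Fin 3, ∑ m, 2 * D (n ι) m *
    ∑ β : Fin 3, (Ja ι n β + Ja ι (Function.update n ι m) β) / 2 *
      Gs β (ν n) (ν (Function.update n ι m)) (U n) (U (Function.update n ι m)) c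

/-- discrete surface integral `∮_{∂E,N} h dS` of a face quantity `h` over the six
faces: sum over the faces of (tangential weights)·h at each face node. -/
def surfInt (ω : Fin (N + 1) → ℝ) (h : Fin 3 → Bool → Node N → ℝ) : ℝ :=
  ∑ β : Fin 3, ∑ s : Bool, ∑ n : Node N,
    if n β = faceIdx N s then tangWeight ω β n * h β s n else 0

end DGSEM

open DGSEM

namespace DGSEM

lemma sum_update_swap {ι κ M : Type*} [Fintype ι] [DecidableEq ι] [Fintype κ] [AddCommMonoid M]
    (d : ι) (f : (ι → κ) → κ → M) :
    ∑ n, ∑ m, f n m = ∑ n, ∑ m, f (Function.update n d m) (n d) := by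
  have hinv : Function.Involutive
      (fun p : (ι → κ) × κ => (Function.update p.1 d p.2, p.1 d)) := fun p => by simp
  rw [← Fintype.sum_prod_type', ← Fintype.sum_prod_type']
  exact (Equiv.sum_comp hinv.toPerm fun p : (ι → κ) × κ => f p.1 p.2).symm

lemma nodeWeight_eq_mul_tangWeight {N : ℕ} (ω : Fin (N + 1) → ℝ) (d : Fin 3) (n : Node N) :
    nodeWeight ω n = ω (n d) * tangWeight ω d n :=
  (Finset.mul_prod_erase _ (fun i => ω (n i)) (Finset.mem_univ d)).symm

lemma tangWeight_update {N : ℕ} (ω : Fin (N + 1) → ℝ) (d : Fin 3) (n : Node N)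
    (m : Fin (N + 1)) : tangWeight ω d (Function.update n d m) = tangWeight ω d n :=
  Finset.prod_congr rfl fun i hi => by
    rw [Function.update_of_ne (Finset.ne_of_mem_erase hi)]

lemma sum_nodeWeight_mul_flux_difference {N : ℕ} (ω b : Fin (N + 1) → ℝ)
    (D : Matrix (Fin (N + 1)) (Fin (N + 1)) ℝ)
    (hSBP : Matrix.diagonal ω * D + (Matrix.diagonal ω * D).transpose = Matrix.diagonal b)
    (d : Fin 3) (S : Node N → Node N → ℝ) (hS : ∀ n n', S n n' = S n' n) :
    ∑ n : Node N, nodeWeight ω n * ∑ m, 2 * D (n d) m * S n (Function.update n d m)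
      = ∑ n : Node N, tangWeight ω d n * (b (n d) * S n n) := by
  have hQ : ∀ i j, ω i * D i j + ω j * D j i = if i = j then b i else 0 := fun i j => by
    simpa [Matrix.diagonal_mul, Matrix.diagonal_apply, mul_comm (D j i)] using congrFun (congrFun hSBP i) j
  have hswap := sum_update_swap d fun (n : Node N) m =>
    tangWeight ω d n * (ω (n d) * D (n d) m) * S n (Function.update n d m)
  simp only [tangWeight_update, Function.update_self, Function.update_idem,
    Function.update_eq_self] at hswap
  calc
    _ = ∑ n : Node N, ∑ m, tangWeight ω d n * (ω (n d) * D (n d) m) *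
            S n (Function.update n d m)
        + ∑ n : Node N, ∑ m, tangWeight ω d n * (ω (n d) * D (n d) m) *
            S n (Function.update n d m) := by
      simp only [← Finset.sum_add_distrib, Finset.mul_sum, nodeWeight_eq_mul_tangWeight ω d]
      exact Finset.sum_congr rfl fun n _ => Finset.sum_congr rfl fun m _ => by ring
    _ = ∑ n : Node N, ∑ m, tangWeight ω d n * (ω (n d) * D (n d) m + ω m * D m (n d)) *
            S n (Function.update n d m) := by
      nth_rewrite 2 [hswap]
      simp only [← Finset.sum_add_distrib]
      refine Finset.sum_congr rfl fun n _ => Finset.sum_congr rfl fun m _ => ?_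
      rw [hS (Function.update n d m) n]
      ring
    _ = _ := by
      refine Finset.sum_congr rfl fun n _ => ?_
      simp [hQ, mul_assoc]

lemma boundary_eq_sum_faceSign {N : ℕ} (hN : 1 ≤ N) (i : Fin (N + 1)) (x : ℝ) :
    (if i = 0 then (-1 : ℝ) else if i = Fin.last N then 1 else 0) * x
      = ∑ s : Bool, if i = faceIdx N s then faceSign s * x else 0 := by
  have hne : (0 : Fin (N + 1)) ≠ Fin.last N := fun h => by
    have := congrArg Fin.val h
    simp at this
    omega
  simp only [Fintype.sum_bool, faceIdx, faceSign]
  by_cases h0 : i = 0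
  · simp [h0, hne]
  · simp [h0]

/-- The volume terms telescope to the surface integral of the interior flux. -/
lemma sum_nodeWeight_mul_Dproj {N : ℕ} (hN : 1 ≤ N) (γ : ℝ) (ω : Fin (N + 1) → ℝ)
    (D : Matrix (Fin (N + 1)) (Fin (N + 1)) ℝ)
    (hSBP : Matrix.diagonal ω * D + (Matrix.diagonal ω * D).transpose
      = Matrix.diagonal (fun i => if i = 0 then (-1 : ℝ) else if i = Fin.last N then 1 else 0))
    (Gs : Fin 3 → (Fin 3 → ℝ) → (Fin 3 → ℝ) → (Fin 5 → ℝ) → (Fin 5 → ℝ) → Fin 5 → ℝ)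
    (hGsym : ∀ ι v v' W W', Gs ι v v' W W' = Gs ι v' v W' W)
    (hGcons : ∀ ι v W, Gs ι v v W W = fun c => eulerFlux γ ι W c - v ι * W c)
    (ν : Node N → Fin 3 → ℝ) (Ja : Fin 3 → Node N → Fin 3 → ℝ)
    (U : Node N → Fin 5 → ℝ) (c : Fin 5) :
    ∑ n : Node N, nodeWeight ω n * Dproj D Gs ν Ja U n c
      = surfInt ω fun β s n =>
          ∑ ι : Fin 3, faceSign s * Ja β n ι * (eulerFlux γ ι (U n) c - ν n ι * U n c) := by
  unfold Dproj surfInt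
  rw [Finset.sum_congr rfl fun n _ => Finset.mul_sum _ _ _, Finset.sum_comm]
  refine Finset.sum_congr rfl fun d _ => ?_
  rw [sum_nodeWeight_mul_flux_difference ω _ D hSBP d (fun n n' => ∑ β : Fin 3,
      (Ja d n β + Ja d n' β) / 2 * Gs β (ν n) (ν n') (U n) (U n') c)
    (fun n n' => Finset.sum_congr rfl fun β _ => by rw [hGsym, add_comm]),
    Finset.sum_comm]
  refine Finset.sum_congr rfl fun n _ => ?_
  simp only [boundary_eq_sum_faceSign hN, Finset.mul_sum (s := (Finset.univ : Finset Bool))]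
  refine Finset.sum_congr rfl fun s _ => ?_
  split_ifs
  · simp only [hGcons, Finset.mul_sum]
    exact Finset.sum_congr rfl fun β _ => by ring
  · simp

lemma sum_node_faces {N : ℕ} (ω : Fin (N + 1) → ℝ) (h : Fin 3 → Bool → Node N → ℝ) :
    ∑ n : Node N, ∑ β : Fin 3, ∑ s : Bool,
      (if n β = faceIdx N s then tangWeight ω β n * h β s n else 0) = surfInt ω h := by
  unfold surfInt
  rw [Finset.sum_comm]
  exact Finset.sum_congr rfl fun β _ => Finset.sum_comm

lemma surfInt_sub {N : ℕ} (ω : Fin (N + 1) → ℝ) (f g : Fin 3 → Bool → Node N → ℝ) :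
    surfInt ω (fun β s n => f β s n - g β s n) = surfInt ω f - surfInt ω g := by
  unfold surfInt
  simp only [← Finset.sum_sub_distrib]
  refine Finset.sum_congr rfl fun β _ => Finset.sum_congr rfl fun s _ =>
    Finset.sum_congr rfl fun n _ => ?_
  split_ifs <;> ring

lemma surfInt_sum {N : ℕ} {κ : Type*} [Fintype κ] (ω : Fin (N + 1) → ℝ)
    (f : κ → Fin 3 → Bool → Node N → ℝ) :
    surfInt ω (fun β s n => ∑ k, f k β s n) = ∑ k, surfInt ω (f k) := by
  simp only [← sum_node_faces]
  conv_rhs => rw [Finset.sum_comm]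
  refine Finset.sum_congr rfl fun n _ => ?_
  conv_rhs => rw [Finset.sum_comm]
  refine Finset.sum_congr rfl fun β _ => ?_
  conv_rhs => rw [Finset.sum_comm]
  refine Finset.sum_congr rfl fun s _ => ?_
  split_ifs
  · rw [Finset.mul_sum]
  · simp

end DGSEM

/-- **Discrete conservation and total energy balance of the split form ALE DGSEM.**
With no assumptions on the fluxes beyond symmetry and consistency, the semi-discrete
split form ALE DGSEM is discretely conservative:
`d/dτ Σ_n ω_n (𝒥U)_n = −∮_{∂E,N} G̃*_n̂ dS` as an identity in ℝ⁵; in particular its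
fifth component gives the discrete total energy balance
`d/dτ ⟨U⁵,𝒥⟩_N = −Σ_ι ∮_{∂E,N} ŝn_ι G_ι^{5,*} dS`. -/
theorem discrete_conservation_and_total_energy_balance
    (N : ℕ) (hN : 1 ≤ N) (γ : ℝ) (hγ : 1 < γ)
    -- LGL weights and SBP derivative matrix with zero row sums
    (ω : Fin (N + 1) → ℝ) (hω : ∀ i, 0 < ω i)
    (D : Matrix (Fin (N + 1)) (Fin (N + 1)) ℝ)
    (hSBP : Matrix.diagonal ω * D + (Matrix.diagonal ω * D).transpose
      = Matrix.diagonal (fun i => if i = 0 then (-1 : ℝ) else if i = Fin.last N then 1 else 0))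
    (hDrow : ∀ i, ∑ j, D i j = 0)
    -- the unknowns: Jacobian and state, differentiable in time, with positive
    -- density and pressure
    (𝒥 : ℝ → Node N → ℝ) (U : ℝ → Node N → Fin 5 → ℝ)
    (h𝒥 : ∀ n, Differentiable ℝ fun τ => 𝒥 τ n)
    (hU : ∀ n c, Differentiable ℝ fun τ => U τ n c)
    (hρpos : ∀ τ n, 0 < U τ n 0)
    (hppos : ∀ τ n, 0 < pres γ (U τ n))
    -- grid velocities and discrete metric terms
    (ν : ℝ → Node N → Fin 3 → ℝ) (Ja : ℝ → Fin 3 → Node N → Fin 3 → ℝ)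
    (hJa : ∀ ι n β, Differentiable ℝ fun τ => Ja τ ι n β)
    (hν : ∀ n β, Differentiable ℝ fun τ => ν τ n β)
    -- two-point volume fluxes: symmetric and consistent
    (Gs : Fin 3 → (Fin 3 → ℝ) → (Fin 3 → ℝ) → (Fin 5 → ℝ) → (Fin 5 → ℝ) → Fin 5 → ℝ)
    (hGsym : ∀ ι v v' W W', Gs ι v v' W W' = Gs ι v' v W' W)
    (hGcons : ∀ ι v W, Gs ι v v W W = fun c => eulerFlux γ ι W c - v ι * W c)
    -- exterior trace data and Cartesian numerical surface fluxes at the face nodes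
    (ρPlus : ℝ → Fin 3 → Bool → Node N → ℝ)
    (hρPlus : ∀ τ β s n, 0 < ρPlus τ β s n)
    (uPlus : ℝ → Fin 3 → Bool → Node N → Fin 3 → ℝ)
    (pPlus : ℝ → Fin 3 → Bool → Node N → ℝ)
    (Gstar : ℝ → Fin 3 → Bool → Node N → Fin 3 → Fin 5 → ℝ)
    -- the semi-discrete split form ALE DGSEM
    (hODE : ∀ τ (n : Node N) (c : Fin 5),
      nodeWeight ω n * deriv (fun t => 𝒥 t n * U t n c) τ
        = -(nodeWeight ω n * Dproj D Gs (ν τ) (Ja τ) (U τ) n c)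
          - ∑ β : Fin 3, ∑ s : Bool,
              (if n β = faceIdx N s then
                tangWeight ω β n *
                  ((∑ ι : Fin 3, faceSign s * Ja τ β n ι * Gstar τ β s n ι c)
                    - ∑ ι : Fin 3, faceSign s * Ja τ β n ι *
                        (eulerFlux γ ι (U τ n) c - ν τ n ι * U τ n c))
              else 0)) :
    -- conclusion: discrete conservation of all five conserved quantities, and in
    -- particular the discrete total energy balance (the fifth component)
    (∀ (τ : ℝ) (c : Fin 5),
      deriv (fun t => ∑ n : Node N, nodeWeight ω n * (𝒥 t n * U t n c)) τ
        = -surfInt ω (fun β s n =>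
            ∑ ι : Fin 3, faceSign s * Ja τ β n ι * Gstar τ β s n ι c))
    ∧ (∀ τ : ℝ,
      deriv (fun t => ∑ n : Node N, nodeWeight ω n * (U t n 4 * 𝒥 t n)) τ
        = -∑ ι : Fin 3,
            surfInt ω (fun β s n => faceSign s * Ja τ β n ι * Gstar τ β s n ι 4)) := by
  have hcons : ∀ (τ : ℝ) (c : Fin 5),
      deriv (fun t => ∑ n : Node N, nodeWeight ω n * (𝒥 t n * U t n c)) τ
        = -surfInt ω (fun β s n =>
            ∑ ι : Fin 3, faceSign s * Ja τ β n ι * Gstar τ β s n ι c) := by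
    intro τ c
    have hd : ∀ n, DifferentiableAt ℝ (fun t => 𝒥 t n * U t n c) τ := fun n =>
      (h𝒥 n τ).fun_mul (hU n c τ)
    rw [deriv_fun_sum fun n _ => (hd n).const_mul _]
    simp only [deriv_const_mul _ (hd _), hODE]
    rw [Finset.sum_sub_distrib, Finset.sum_neg_distrib,
      sum_nodeWeight_mul_Dproj hN γ ω D hSBP Gs hGsym hGcons,
      sum_node_faces ω fun β s n => (∑ ι : Fin 3, faceSign s * Ja τ β n ι * Gstar τ β s n ι c)
        - ∑ ι : Fin 3, faceSign s * Ja τ β n ι *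
            (eulerFlux γ ι (U τ n) c - ν τ n ι * U τ n c),
      surfInt_sub]
    ring
  refine ⟨hcons, fun τ => ?_⟩
  simp only [mul_comm (U _ _ 4)]
  rw [hcons τ 4, surfInt_sum]

end
end

section
/- SBP three-term split identity (equation C.3 of the paper, with the oriented jump ⟦a⟧_(i,j) := a_i − a_j and averages ⟨b⟩_(i,j) := ½(b_i + b_j)). For all nodal value sequences a, b, c : {0,…,N} → ℝ: Σ_{i,j=0}^{N} Q_ij · (a_i − a_j) · ½(b_i + b_j) · ½(c_i + c_j) = ½ Σ_{i,j=0}^{N} Q_ij a_i b_i c_j + ½ Σ_{i,j=0}^{N} Q_ij a_i b_j c_i + ½ Σ_{i,j=0}^{N} Q_ij a_i b_j c_j − ( a_N b_N c_N − a_0 b_0 c_0 ). -/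
/-- Summation by parts for two-point functions: `Σ Q_ij f(j, i) = Σ (B_ij - Q_ij) f(i, j)` when
`Q + Qᵀ = B` is diagonal. -/
theorem Matrix.sum_mul_swap_of_add_transpose_eq_diagonal {ι R : Type*} [Fintype ι] [DecidableEq ι]
    [CommRing R] {Q : Matrix ι ι R} {d : ι → R} (h : Q + Q.transpose = Matrix.diagonal d)
    (f : ι → ι → R) :
    ∑ i, ∑ j, Q i j * f j i = ∑ i, d i * f i i - ∑ i, ∑ j, Q i j * f i j := by
  have hQ (i j : ι) : Q j i * f i j = Matrix.diagonal d i j * f i j - Q i j * f i j := by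
    rw [← h, Matrix.add_apply, Matrix.transpose_apply]
    ring
  rw [Finset.sum_comm, Finset.sum_congr rfl fun i _ => Finset.sum_congr rfl fun j _ => hQ i j]
  simp [Finset.sum_sub_distrib, Matrix.diagonal_apply]

/-- The diagonal `(-1, 0, …, 0, 1)` sums a function to the difference of its boundary values. -/
theorem Fin.sum_boundary_mul {N : ℕ} (hN : 1 ≤ N) (g : Fin (N + 1) → ℝ) :
    ∑ i, (if i = 0 then (-1 : ℝ) else if i = Fin.last N then 1 else 0) * g i
      = g (Fin.last N) - g 0 := by
  have hne : Fin.last N ≠ 0 := by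
    simp [Fin.ext_iff]
    lia
  have hsplit (i : Fin (N + 1)) :
      (if i = 0 then (-1 : ℝ) else if i = Fin.last N then 1 else 0) * g i
        = (if i = Fin.last N then g i else 0) - (if i = 0 then g i else 0) := by
    by_cases h0 : i = 0
    · simp [h0, hne.symm]
    · simp [h0]
  simp [hsplit, Finset.sum_sub_distrib]

/-- **SBP three-term split identity** (equation (C.3) of the paper, with the oriented
jump `⟦a⟧_(i,j) = a_i − a_j` and averages `⟨b⟩_(i,j) = ½(b_i + b_j)`).
`Q` is an SBP matrix: `Q + Qᵀ = B` with `B = diag(−1, 0, …, 0, 1)`, and every row of `Q`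
sums to zero.  Then for all nodal value sequences `a, b, c`:
`Σ_{i,j} Q_ij ⟦a⟧⟨b⟩⟨c⟩ = ½ Σ Q_ij a_i b_i c_j + ½ Σ Q_ij a_i b_j c_i + ½ Σ Q_ij a_i b_j c_j
  − (a_N b_N c_N − a_0 b_0 c_0)`. -/
theorem sbp_three_term_split_identity (N : ℕ) (hN : 1 ≤ N)
    (Q : Matrix (Fin (N + 1)) (Fin (N + 1)) ℝ)
    (hSBP : Q + Q.transpose
      = Matrix.diagonal (fun i => if i = 0 then (-1 : ℝ) else if i = Fin.last N then 1 else 0))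
    (hrow : ∀ i, ∑ j, Q i j = 0)
    (a b c : Fin (N + 1) → ℝ) :
    ∑ i, ∑ j, Q i j * (a i - a j) * ((b i + b j) / 2) * ((c i + c j) / 2)
      = (1 / 2) * (∑ i, ∑ j, Q i j * a i * b i * c j)
        + (1 / 2) * (∑ i, ∑ j, Q i j * a i * b j * c i)
        + (1 / 2) * (∑ i, ∑ j, Q i j * a i * b j * c j)
        - (a (Fin.last N) * b (Fin.last N) * c (Fin.last N) - a 0 * b 0 * c 0) := by
  let f : Fin (N + 1) → Fin (N + 1) → ℝ := fun i j => a i * (b i + b j) * (c i + c j)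
  have hswap := Matrix.sum_mul_swap_of_add_transpose_eq_diagonal hSBP f
  rw [Fin.sum_boundary_mul hN (fun i => f i i)] at hswap
  have hdiag : ∑ i, ∑ j, Q i j * (a i * b i * c i) = 0 := by
    simp [← Finset.sum_mul, hrow]
  have hexpand : ∑ i, ∑ j, Q i j * f i j
      = ∑ i, ∑ j, Q i j * (a i * b i * c i) + ∑ i, ∑ j, Q i j * a i * b i * c j
        + ∑ i, ∑ j, Q i j * a i * b j * c i + ∑ i, ∑ j, Q i j * a i * b j * c j := by
    simp only [← Finset.sum_add_distrib]
    refine Finset.sum_congr rfl fun i _ => Finset.sum_congr rfl fun j _ => ?_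
    simp only [f]
    ring
  have hlhs : ∑ i, ∑ j, Q i j * (a i - a j) * ((b i + b j) / 2) * ((c i + c j) / 2)
      = (1 / 4) * (∑ i, ∑ j, Q i j * f i j - ∑ i, ∑ j, Q i j * f j i) := by
    simp only [← Finset.sum_sub_distrib, Finset.mul_sum]
    refine Finset.sum_congr rfl fun i _ => Finset.sum_congr rfl fun j _ => ?_
    simp only [f]
    ring
  rw [hlhs, hswap, hexpand, hdiag]
  simp only [f]
  ring
end

section
/- Entropy contraction of SBP flux differencing with an entropy conservative two-point flux. Let d ≥ 1, let W : {0,…,N} → ℝ^d (nodal entropy variables), ψ : {0,…,N} → ℝ (nodal entropy potential), and let G : {0,…,N} × {0,…,N} → ℝ^d be a symmetric two-point flux (G(i,m) = G(m,i)) satisfying the discrete entropy condition (W_i − W_m) · G(i,m) = ψ_i − ψ_m for all i, m (Euclidean dot product). Then Σ_{i,m=0}^{N} 2 Q_im · W_i · G(i,m) = ( W_N · G(N,N) − ψ_N ) − ( W_0 · G(0,0) − ψ_0 ). -/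
/-- If `Q + Qᵀ = diag b`, the rows of `Q` sum to zero and `A i m - A m i = ψ i - ψ m`, then
`∑ i, ∑ m, 2 * Q i m * A i m` reduces to the diagonal sum `∑ i, b i * (A i i - ψ i)`. -/
theorem sum_two_mul_eq_sum_diagonal {ι R : Type*} [Fintype ι] [DecidableEq ι] [CommRing R]
    {Q A : Matrix ι ι R} {b ψ : ι → R} (hQ : Q + Q.transpose = Matrix.diagonal b)
    (hrow : ∀ i, ∑ j, Q i j = 0) (hA : ∀ i m, A i m - A m i = ψ i - ψ m) :
    ∑ i, ∑ m, 2 * Q i m * A i m = ∑ i, b i * (A i i - ψ i) := by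
  have hsum : ∑ i, ∑ m, Q i m * ψ i = 0 := by
    simp [← Finset.sum_mul, hrow]
  have hterm (i m : ι) : Q i m * A i m + Q m i * A m i
      = Matrix.diagonal b i m * (A i m - ψ i) + Q i m * ψ i + Q m i * ψ m := by
    rw [← hQ, Matrix.add_apply, Matrix.transpose_apply]
    linear_combination (-Q m i) * hA i m
  have hswap (f : ι → ι → R) : ∑ i, ∑ m, f m i = ∑ i, ∑ m, f i m := Finset.sum_comm
  calc ∑ i, ∑ m, 2 * Q i m * A i m
      = ∑ i, ∑ m, (Q i m * A i m + Q m i * A m i) := by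
        simp only [Finset.sum_add_distrib, hswap fun i m => Q i m * A i m, two_mul, add_mul]
    _ = ∑ i, ∑ m, Matrix.diagonal b i m * (A i m - ψ i) := by
        simp only [hterm, Finset.sum_add_distrib, hswap fun i m => Q i m * ψ i, hsum, add_zero]
    _ = ∑ i, b i * (A i i - ψ i) := by
        simp [Matrix.diagonal_apply]


/-- **Entropy contraction of SBP flux differencing with an entropy conservative
two-point flux.**  `Q` is an SBP matrix (`Q + Qᵀ = diag(−1,0,…,0,1)`) whose rows sum to
zero.  Let `W` be nodal entropy variables in `ℝ^d`, `ψ` a nodal entropy potential and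
`G` a symmetric two-point flux satisfying the discrete entropy condition
`(W_i − W_m)·G(i,m) = ψ_i − ψ_m`.  Then
`Σ_{i,m} 2 Q_im W_i·G(i,m) = (W_N·G(N,N) − ψ_N) − (W_0·G(0,0) − ψ_0)`. -/
theorem sbp_entropy_contraction (N d : ℕ) (hN : 1 ≤ N) (hd : 1 ≤ d)
    (Q : Matrix (Fin (N + 1)) (Fin (N + 1)) ℝ)
    (hSBP : Q + Q.transpose
      = Matrix.diagonal (fun i => if i = 0 then (-1 : ℝ) else if i = Fin.last N then 1 else 0))
    (hrow : ∀ i, ∑ j, Q i j = 0)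
    (W : Fin (N + 1) → Fin d → ℝ) (ψ : Fin (N + 1) → ℝ)
    (G : Fin (N + 1) → Fin (N + 1) → Fin d → ℝ)
    (hGsym : ∀ i m, G i m = G m i)
    (hEC : ∀ i m, ∑ l, (W i l - W m l) * G i m l = ψ i - ψ m) :
    ∑ i, ∑ m, 2 * Q i m * (∑ l, W i l * G i m l)
      = ((∑ l, W (Fin.last N) l * G (Fin.last N) (Fin.last N) l) - ψ (Fin.last N))
        - ((∑ l, W 0 l * G 0 0 l) - ψ 0) := by
  have hA (i m : Fin (N + 1)) :
      (∑ l, W i l * G i m l) - ∑ l, W m l * G m i l = ψ i - ψ m := by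
    rw [← hEC i m, hGsym m i, ← Finset.sum_sub_distrib]
    simp only [sub_mul]
  have hlast : Fin.last N ≠ 0 := Fin.ne_of_gt (by simpa [Fin.lt_def] using Nat.succ_le_iff.mp hN)
  rw [sum_two_mul_eq_sum_diagonal (A := fun i m => ∑ l, W i l * G i m l) hSBP hrow hA,
    Fintype.sum_eq_add (Fin.last N) 0 hlast (by rintro i ⟨h, h'⟩; simp [h, h'])]
  simp only [if_neg hlast, if_true]
  ring
end

section
/- The Ranocha (RA) two-point flux is entropy conservative on moving meshes: for every ι = 1,2,3, ⟦w⟧ · G_ι^{RA} = ⟦ρ u_ι⟧ − ⟨ν_ι⟩ · ⟦ρ⟧, where ⟦w⟧ ∈ ℝ⁵ is the componentwise jump of the entropy variables of the two interface states, the dot product is the Euclidean one in ℝ⁵, and ⟦ρ u_ι⟧ = ρ⁺u_ι⁺ − ρ⁻u_ι⁻. -/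
noncomputable section

/-- arithmetic mean `⟨a⟩ = ½(a⁻ + a⁺)` of the interior value `am` and the exterior
value `ap`. -/
def avgI (am ap : ℝ) : ℝ := (am + ap) / 2

/-- logarithmic mean `⟨a⟩^log = (a⁺ − a⁻)/(log a⁺ − log a⁻)` (equal values: `a⁻`). -/
def logMean (am ap : ℝ) : ℝ :=
  if ap = am then am else (ap - am) / (Real.log ap - Real.log am)

/-- entropy variables `w = ((γ−ς)/(γ−1) − ρ|u⃗|²/(2p), ρu₁/p, ρu₂/p, ρu₃/p, −ρ/p)`
of a state, where `ς = log(p ρ^{−γ})`. -/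
def entVars (γ ρ : ℝ) (u : Fin 3 → ℝ) (p : ℝ) : Fin 5 → ℝ :=
  ![(γ - Real.log (p * ρ ^ (-γ))) / (γ - 1) - ρ * (∑ d, (u d) ^ 2) / (2 * p),
    ρ * u 0 / p, ρ * u 1 / p, ρ * u 2 / p, -ρ / p]

/-- the special velocity average `\overline{|u⃗|}² = Σ_υ (2⟨u_υ⟩² − ⟨u_υ²⟩)`. -/
def uBarSq (um up : Fin 3 → ℝ) : ℝ :=
  ∑ υ, (2 * avgI (um υ) (up υ) ^ 2 - avgI ((um υ) ^ 2) ((up υ) ^ 2))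

/-- the Ranocha (RA) two-point flux in direction `ι` on a moving mesh, for interface
states `(ρ⁻,u⃗⁻,p⁻)`, `(ρ⁺,u⃗⁺,p⁺)` and grid velocities `ν⃗⁻, ν⃗⁺`, with
`e± = p±/((γ−1)ρ±)`. -/
def fluxRA (γ : ℝ) (ρm ρp : ℝ) (um up : Fin 3 → ℝ) (pm pp : ℝ) (νm νp : Fin 3 → ℝ)
    (ι : Fin 3) : Fin 5 → ℝ :=
  ![logMean ρm ρp * avgI (um ι - νm ι) (up ι - νp ι),
    logMean ρm ρp * avgI (um ι - νm ι) (up ι - νp ι) * avgI (um 0) (up 0)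
      + (if ι = 0 then avgI pm pp else 0),
    logMean ρm ρp * avgI (um ι - νm ι) (up ι - νp ι) * avgI (um 1) (up 1)
      + (if ι = 1 then avgI pm pp else 0),
    logMean ρm ρp * avgI (um ι - νm ι) (up ι - νp ι) * avgI (um 2) (up 2)
      + (if ι = 2 then avgI pm pp else 0),
    logMean ρm ρp *
        (1 / logMean (((γ - 1) * ρm) / pm) (((γ - 1) * ρp) / pp) + 1 / 2 * uBarSq um up) *
        avgI (um ι - νm ι) (up ι - νp ι)
      + 2 * avgI pm pp * avgI (um ι) (up ι) - avgI (pm * um ι) (pp * up ι)]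

theorem logMean_mul_log_sub_log {a b : ℝ} (ha : 0 < a) (hb : 0 < b) :
    logMean a b * (Real.log b - Real.log a) = b - a := by
  unfold logMean
  split_ifs with h
  · simp [h]
  · have : Real.log b - Real.log a ≠ 0 :=
      sub_ne_zero.2 fun hl => h (Real.log_injOn_pos hb ha hl)
    field_simp

theorem logMean_ne_zero {a b : ℝ} (ha : 0 < a) (hb : 0 < b) : logMean a b ≠ 0 := by
  by_cases h : b = a
  · simp [logMean, h, ha.ne']
  · intro hL
    have := logMean_mul_log_sub_log ha hb
    rw [hL, zero_mul] at this
    exact h (sub_eq_zero.1 this.symm)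

/-- The part of the first entropy variable that does not involve the velocity, in terms of
`ρ` and `(γ - 1) ρ / p`. -/
theorem sub_log_div_eq {γ ρ p : ℝ} (hγ : 1 < γ) (hρ : 0 < ρ) (hp : 0 < p) :
    (γ - Real.log (p * ρ ^ (-γ))) / (γ - 1) =
      Real.log ρ + (Real.log ((γ - 1) * ρ / p) + (γ - Real.log (γ - 1))) / (γ - 1) := by
  have hc : γ - 1 ≠ 0 := (sub_pos.2 hγ).ne'
  rw [Real.log_mul hp.ne' (Real.rpow_pos_of_pos hρ _).ne', Real.log_rpow hρ,
    Real.log_div (mul_ne_zero hc hρ.ne') hp.ne', Real.log_mul hc hρ.ne']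
  field_simp
  ring

/-- **The Ranocha (RA) two-point flux is entropy conservative on moving meshes**:
for every `ι = 1,2,3`, `⟦w⟧·G_ι^{RA} = ⟦ρ u_ι⟧ − ⟨ν_ι⟩·⟦ρ⟧`.
(Note `1/e = (γ−1)ρ/p`, so `⟨1/e⟩^log = logMean ((γ−1)ρ⁻/p⁻) ((γ−1)ρ⁺/p⁺)`.) -/
theorem ranocha_flux_entropy_conservative (γ : ℝ) (hγ : 1 < γ)
    (ρm ρp pm pp : ℝ) (um up νm νp : Fin 3 → ℝ)
    (hρm : 0 < ρm) (hρp : 0 < ρp) (hpm : 0 < pm) (hpp : 0 < pp) :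
    ∀ ι : Fin 3,
      ∑ c : Fin 5, (entVars γ ρp up pp c - entVars γ ρm um pm c) * fluxRA γ ρm ρp um up pm pp νm νp ι c
        = (ρp * up ι - ρm * um ι) - avgI (νm ι) (νp ι) * (ρp - ρm) := by
  intro ι
  have hc : 0 < γ - 1 := sub_pos.2 hγ
  have hbm : 0 < (γ - 1) * ρm / pm := by positivity
  have hbp : 0 < (γ - 1) * ρp / pp := by positivity
  have hR := logMean_mul_log_sub_log hρm hρp
  have hL := logMean_mul_log_sub_log hbm hbp
  have hL0 := logMean_ne_zero hbm hbp
  have hlog : (Real.log ((γ - 1) * ρp / pp) - Real.log ((γ - 1) * ρm / pm)) / (γ - 1) =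
      (ρp / pp - ρm / pm) * (1 / logMean ((γ - 1) * ρm / pm) ((γ - 1) * ρp / pp)) := by
    rw [mul_one_div, div_eq_div_iff hc.ne' hL0, mul_comm, hL]
    ring
  have hw : ∀ {ρ p : ℝ} (u : Fin 3 → ℝ), 0 < ρ → 0 < p → entVars γ ρ u p =
      ![Real.log ρ + (Real.log ((γ - 1) * ρ / p) + (γ - Real.log (γ - 1))) / (γ - 1)
        - ρ / p * (∑ d, (u d) ^ 2) / 2,
        ρ / p * u 0, ρ / p * u 1, ρ / p * u 2, -(ρ / p)] := by
    intro ρ p u hρ hp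
    rw [entVars, sub_log_div_eq hγ hρ hp]
    congr! 2 <;> ring_nf
  rw [hw up hρp hpp, hw um hρm hpm]
  obtain ⟨bm, hbm_def⟩ : ∃ b, b = ρm / pm := ⟨_, rfl⟩
  obtain ⟨bp, hbp_def⟩ : ∃ b, b = ρp / pp := ⟨_, rfl⟩
  have em : ρm = bm * pm := by rw [hbm_def]; field_simp
  have ep : ρp = bp * pp := by rw [hbp_def]; field_simp
  unfold fluxRA
  rw [← hbm_def, ← hbp_def] at hlog ⊢
  generalize logMean ((γ - 1) * ρm / pm) ((γ - 1) * ρp / pp) = L at *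
  generalize Real.log ((γ - 1) * ρp / pp) = lp at *
  generalize Real.log ((γ - 1) * ρm / pm) = lm at *
  generalize logMean ρm ρp = R at *
  generalize Real.log ρm = rm at *
  generalize Real.log ρp = rp at *
  generalize 1 / L = K at *
  simp only [Fin.sum_univ_five, Fin.sum_univ_three, uBarSq, avgI]
  clear hbm_def hbp_def
  subst em ep
  fin_cases ι
  · simp
    linear_combination (um 0 - νm 0 + (up 0 - νp 0)) / 2 * (hR + R * hlog)
  · simp
    linear_combination (um 1 - νm 1 + (up 1 - νp 1)) / 2 * (hR + R * hlog)
  · simp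
    linear_combination (um 2 - νm 2 + (up 2 - νp 2)) / 2 * (hR + R * hlog)

end
end

section
/- The Chandrashekar (CH) two-point flux is entropy conservative on moving meshes: for every ι = 1,2,3, ⟦w⟧ · G_ι^{CH} = ⟦ρ u_ι⟧ − ⟨ν_ι⟩ · ⟦ρ⟧, where ⟦w⟧ ∈ ℝ⁵ is the componentwise jump of the entropy variables of the two interface states, the dot product is the Euclidean one in ℝ⁵, and ⟦ρ u_ι⟧ = ρ⁺u_ι⁺ − ρ⁻u_ι⁻. -/
noncomputable section

/-- the Chandrashekar (CH) two-point flux in direction `ι` on a moving mesh, for interface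
states `(ρ⁻,u⃗⁻,p⁻)`, `(ρ⁺,u⃗⁺,p⁺)` and grid velocities `ν⃗⁻, ν⃗⁺`, with
`e± = p±/((γ−1)ρ±)`. -/
def fluxCH (γ : ℝ) (ρm ρp : ℝ) (um up : Fin 3 → ℝ) (pm pp : ℝ) (νm νp : Fin 3 → ℝ)
    (ι : Fin 3) : Fin 5 → ℝ :=
  ![logMean ρm ρp * avgI (um ι - νm ι) (up ι - νp ι),
    logMean ρm ρp * avgI (um ι - νm ι) (up ι - νp ι) * avgI (um 0) (up 0)
      + (if ι = 0 then avgI ρm ρp / avgI (ρm / pm) (ρp / pp) else 0),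
    logMean ρm ρp * avgI (um ι - νm ι) (up ι - νp ι) * avgI (um 1) (up 1)
      + (if ι = 1 then avgI ρm ρp / avgI (ρm / pm) (ρp / pp) else 0),
    logMean ρm ρp * avgI (um ι - νm ι) (up ι - νp ι) * avgI (um 2) (up 2)
      + (if ι = 2 then avgI ρm ρp / avgI (ρm / pm) (ρp / pp) else 0),
    logMean ρm ρp *
        (1 / logMean (((γ - 1) * ρm) / pm) (((γ - 1) * ρp) / pp) + 1 / 2 * uBarSq um up) *
        avgI (um ι - νm ι) (up ι - νp ι)
      + avgI ρm ρp / avgI (ρm / pm) (ρp / pp) * avgI (um ι) (up ι)]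

/-- The defining property `⟨a⟩^log · ⟦log a⟧ = ⟦a⟧` of the logarithmic mean. -/
theorem logMean_mul_log_sub {am ap : ℝ} (hm : 0 < am) (hp : 0 < ap) :
    logMean am ap * (Real.log ap - Real.log am) = ap - am := by
  unfold logMean
  split_ifs with h
  · simp [h]
  · have hlog : Real.log ap - Real.log am ≠ 0 := fun h' =>
      h (Real.log_injOn_pos hp hm (sub_eq_zero.mp h'))
    field_simp

theorem logMean_ne_zero_s7 {am ap : ℝ} (hm : 0 < am) (hp : 0 < ap) : logMean am ap ≠ 0 := by
  intro h0
  have h := logMean_mul_log_sub hm hp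
  rw [h0, zero_mul] at h
  have hne := hm.ne'
  rw [logMean, if_pos (by linarith)] at h0
  exact hne h0

theorem sub_mul_one_div_logMean {am ap : ℝ} (hm : 0 < am) (hp : 0 < ap) :
    (ap - am) * (1 / logMean am ap) = Real.log ap - Real.log am := by
  rw [← logMean_mul_log_sub hm hp]
  have := logMean_ne_zero_s7 hm hp
  field_simp

/-- The first entropy variable in terms of `log ρ` and `log (1/e)`. -/
theorem entVars_zero {γ ρ p : ℝ} (hγ : 1 < γ) (u : Fin 3 → ℝ) (hρ : 0 < ρ) (hp : 0 < p) :
    entVars γ ρ u p 0 = (γ - Real.log (γ - 1)) / (γ - 1) + Real.log ρ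
      + Real.log ((γ - 1) * ρ / p) / (γ - 1) - ρ / p * (∑ d, (u d) ^ 2) / 2 := by
  have hγ' : 0 < γ - 1 := sub_pos.mpr hγ
  have hs : Real.log (p * ρ ^ (-γ)) = Real.log p - γ * Real.log ρ := by
    rw [Real.log_mul hp.ne' (Real.rpow_pos_of_pos hρ _).ne', Real.log_rpow hρ]
    ring
  have he : Real.log ((γ - 1) * ρ / p) = Real.log (γ - 1) + Real.log ρ - Real.log p := by
    rw [Real.log_div (by positivity) hp.ne', Real.log_mul hγ'.ne' hρ.ne']
  simp only [entVars, Matrix.cons_val_zero, hs, he]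
  field_simp
  ring

/-- **The Chandrashekar (CH) two-point flux is entropy conservative on moving meshes**:
for every `ι = 1,2,3`, `⟦w⟧·G_ι^{CH} = ⟦ρ u_ι⟧ − ⟨ν_ι⟩·⟦ρ⟧`.
(Note `1/e = (γ−1)ρ/p`, so `⟨1/e⟩^log = logMean ((γ−1)ρ⁻/p⁻) ((γ−1)ρ⁺/p⁺)`.) -/
theorem chandrashekar_flux_entropy_conservative (γ : ℝ) (hγ : 1 < γ)
    (ρm ρp pm pp : ℝ) (um up νm νp : Fin 3 → ℝ)
    (hρm : 0 < ρm) (hρp : 0 < ρp) (hpm : 0 < pm) (hpp : 0 < pp) :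
    ∀ ι : Fin 3,
      ∑ c : Fin 5, (entVars γ ρp up pp c - entVars γ ρm um pm c) * fluxCH γ ρm ρp um up pm pp νm νp ι c
        = (ρp * up ι - ρm * um ι) - avgI (νm ι) (νp ι) * (ρp - ρm) := by
  intro ι
  have hγ' : 0 < γ - 1 := sub_pos.mpr hγ
  have hL := logMean_mul_log_sub hρm hρp
  have hM := sub_mul_one_div_logMean (am := (γ - 1) * ρm / pm) (ap := (γ - 1) * ρp / pp)
    (by positivity) (by positivity)
  have hP : avgI ρm ρp / avgI (ρm / pm) (ρp / pp) * (ρm / pm + ρp / pp) = ρm + ρp := by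
    have : ρm / pm + ρp / pp ≠ 0 := by positivity
    simp only [avgI]
    field_simp
  have hM' : (ρp / pp - ρm / pm) * (1 / logMean ((γ - 1) * ρm / pm) ((γ - 1) * ρp / pp))
      = Real.log ((γ - 1) * ρp / pp) / (γ - 1) - Real.log ((γ - 1) * ρm / pm) / (γ - 1) := by
    rw [← sub_div, ← hM]
    field_simp
  rw [Fin.sum_univ_five, entVars_zero hγ up hρp hpp, entVars_zero hγ um hρm hpm]
  simp only [entVars, fluxCH, uBarSq, Fin.sum_univ_three, Matrix.cons_val, neg_div,
    mul_div_right_comm _ _ pm, mul_div_right_comm _ _ pp] at hM' ⊢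
  generalize avgI ρm ρp / avgI (ρm / pm) (ρp / pp) = P at *
  generalize 1 / logMean _ ((γ - 1) / pp * ρp) = N at *
  generalize Real.log ((γ - 1) / pp * ρp) / (γ - 1) = lp at *
  generalize Real.log ((γ - 1) / pm * ρm) / (γ - 1) = lm at *
  generalize logMean ρm ρp = L at *
  generalize ρp / pp = βp at *
  generalize ρm / pm = βm at *
  simp only [avgI]
  fin_cases ι <;> simp
  · linear_combination (um 0 - νm 0 + (up 0 - νp 0)) / 2 * (hL - L * hM') + (up 0 - um 0) / 2 * hP
  · linear_combination (um 1 - νm 1 + (up 1 - νp 1)) / 2 * (hL - L * hM') + (up 1 - um 1) / 2 * hP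
  · linear_combination (um 2 - νm 2 + (up 2 - νp 2)) / 2 * (hL - L * hM') + (up 2 - um 2) / 2 * hP

end
end

section
/- Kinetic energy form of the ALE Euler flux divergence (the physical-space identity in equation (2.19) of the paper). Fix γ > 1 and let ρ, p : ℝ³ → ℝ and u⃗, ν⃗ : ℝ³ → ℝ³ be differentiable at a point x₀ ∈ ℝ³. Define E := p/(γ−1) + ½ρ|u⃗|², the state U := (ρ, ρu₁, ρu₂, ρu₃, E) : ℝ³ → ℝ⁵, the Euler fluxes f_ι := (ρu_ι, ρu_ιu₁ + pδ_{ι1}, ρu_ιu₂ + pδ_{ι2}, ρu_ιu₃ + pδ_{ι3}, u_ι(E+p)) for ι = 1,2,3, the ALE fluxes g_ι := f_ι − ν_ι·U, the vector v := (−½|u⃗|², u₁, u₂, u₃, 0), and the kinetic energy 𝕜 := ½ρ|u⃗|². Then at x₀: v · Σ_{ι=1}^{3} ∂g_ι/∂x_ι = Σ_{ι=1}^{3} ∂((u_ι − ν_ι)·𝕜)/∂x_ι + Σ_{ι=1}^{3} (∂p/∂x_ι)·u_ι, where the partial derivatives act componentwise and the dot product is the Euclidean one in ℝ⁵. -/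
noncomputable section

/-- total energy `E = p/(γ−1) + ½ρ|u⃗|²` as a field on `ℝ³`. -/
def totEnergy (γ : ℝ) (ρ p : (Fin 3 → ℝ) → ℝ) (u : (Fin 3 → ℝ) → Fin 3 → ℝ)
    (x : Fin 3 → ℝ) : ℝ :=
  p x / (γ - 1) + 1 / 2 * ρ x * ∑ d, (u x d) ^ 2

/-- Cartesian Euler flux `f_ι` as a field on `ℝ³`. -/
def eulerFluxField (γ : ℝ) (ρ p : (Fin 3 → ℝ) → ℝ) (u : (Fin 3 → ℝ) → Fin 3 → ℝ)
    (ι : Fin 3) (x : Fin 3 → ℝ) : Fin 5 → ℝ :=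
  ![ρ x * u x ι,
    ρ x * u x ι * u x 0 + (if ι = 0 then p x else 0),
    ρ x * u x ι * u x 1 + (if ι = 1 then p x else 0),
    ρ x * u x ι * u x 2 + (if ι = 2 then p x else 0),
    u x ι * (totEnergy γ ρ p u x + p x)]

/-- state vector `U = (ρ, ρu₁, ρu₂, ρu₃, E)` as a field on `ℝ³`. -/
def stateField (γ : ℝ) (ρ p : (Fin 3 → ℝ) → ℝ) (u : (Fin 3 → ℝ) → Fin 3 → ℝ)
    (x : Fin 3 → ℝ) : Fin 5 → ℝ :=
  ![ρ x, ρ x * u x 0, ρ x * u x 1, ρ x * u x 2, totEnergy γ ρ p u x]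

/-- ALE flux `g_ι = f_ι − ν_ι U`. -/
def aleFluxField (γ : ℝ) (ρ p : (Fin 3 → ℝ) → ℝ) (u ν : (Fin 3 → ℝ) → Fin 3 → ℝ)
    (ι : Fin 3) (x : Fin 3 → ℝ) : Fin 5 → ℝ :=
  fun c => eulerFluxField γ ρ p u ι x c - ν x ι * stateField γ ρ p u x c

/-- Kinetic energy product rule: contracting the derivatives of a mass flux `m` and of the momentum
fluxes `m w_d` with `(-½|w|², w)` gives the derivative of `½ m |w|²`. -/
theorem fderiv_mul_half_sum_sq {V : Type*} [NormedAddCommGroup V] [NormedSpace ℝ V]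
    {κ : Type*} [Fintype κ] {m : V → ℝ} {w : V → κ → ℝ} {x : V}
    (hm : DifferentiableAt ℝ m x) (hw : ∀ d, DifferentiableAt ℝ (fun y => w y d) x) (e : V) :
    fderiv ℝ (fun y => m y * (1 / 2 * ∑ d, w y d ^ 2)) x e
      = -(1 / 2) * (∑ d, w x d ^ 2) * fderiv ℝ m x e
        + ∑ d, w x d * fderiv ℝ (fun y => m y * w y d) x e := by
  have hsq : HasFDerivAt (fun y => ∑ d, w y d ^ 2)
      (∑ d, (2 * w x d) • fderiv ℝ (fun y => w y d) x) x := by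
    refine HasFDerivAt.fun_sum fun d _ => ?_
    simpa using (hw d).hasFDerivAt.pow 2
  have hmom : ∀ d, fderiv ℝ (fun y => m y * w y d) x e
      = m x * fderiv ℝ (fun y => w y d) x e + w x d * fderiv ℝ m x e := fun d => by
    rw [(hm.hasFDerivAt.fun_mul (hw d).hasFDerivAt).fderiv]
    simp
  rw [(hm.hasFDerivAt.fun_mul (hsq.const_mul (1 / 2))).fderiv]
  simp only [hmom, add_apply, smul_apply, sum_apply, smul_eq_mul, mul_add,
    Finset.sum_add_distrib, Finset.mul_sum, Finset.sum_mul]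
  rw [← Finset.sum_add_distrib, ← Finset.sum_add_distrib, ← Finset.sum_add_distrib]
  exact Finset.sum_congr rfl fun d _ => by ring

/-- Derivative of a sum whose second term is present only if the constant proposition `P` holds. -/
theorem fderiv_add_ite_zero {V : Type*} [NormedAddCommGroup V] [NormedSpace ℝ V]
    {a p : V → ℝ} {x : V} (ha : DifferentiableAt ℝ a x) (hp : DifferentiableAt ℝ p x)
    (P : Prop) [Decidable P] (e : V) :
    fderiv ℝ (fun y => a y + if P then p y else 0) x e
      = fderiv ℝ a x e + if P then fderiv ℝ p x e else 0 := by
  split_ifs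
  · rw [fderiv_fun_add ha hp]; rfl
  · simp

/-- **Kinetic energy form of the ALE Euler flux divergence** (the physical-space
identity in equation (2.19)).  With `v = (−½|u⃗|², u₁, u₂, u₃, 0)` and
`𝕜 = ½ρ|u⃗|²`, at every point where all fields are differentiable:
`v·Σ_ι ∂g_ι/∂x_ι = Σ_ι ∂((u_ι − ν_ι)𝕜)/∂x_ι + Σ_ι (∂p/∂x_ι)·u_ι`. -/
theorem kinetic_energy_flux_divergence (γ : ℝ) (hγ : 1 < γ)
    (ρ p : (Fin 3 → ℝ) → ℝ) (u ν : (Fin 3 → ℝ) → Fin 3 → ℝ) (x₀ : Fin 3 → ℝ)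
    (hρ : DifferentiableAt ℝ ρ x₀) (hp : DifferentiableAt ℝ p x₀)
    (hu : ∀ d, DifferentiableAt ℝ (fun x => u x d) x₀)
    (hν : ∀ d, DifferentiableAt ℝ (fun x => ν x d) x₀) :
    ∑ ι : Fin 3, ∑ c : Fin 5,
        (![-(1 / 2) * ∑ d, (u x₀ d) ^ 2, u x₀ 0, u x₀ 1, u x₀ 2, 0] : Fin 5 → ℝ) c *
          fderiv ℝ (fun x => aleFluxField γ ρ p u ν ι x c) x₀ (Pi.single ι 1)
      = (∑ ι : Fin 3,
          fderiv ℝ (fun x => (u x ι - ν x ι) * (1 / 2 * ρ x * ∑ d, (u x d) ^ 2)) x₀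
            (Pi.single ι 1))
        + ∑ ι : Fin 3, fderiv ℝ p x₀ (Pi.single ι 1) * u x₀ ι := by
  have hm : ∀ ι, DifferentiableAt ℝ (fun x => ρ x * (u x ι - ν x ι)) x₀ :=
    fun ι => hρ.mul ((hu ι).sub (hν ι))
  have hmu : ∀ ι d, DifferentiableAt ℝ (fun x => ρ x * (u x ι - ν x ι) * u x d) x₀ :=
    fun ι d => (hm ι).mul (hu d)
  have hmass : ∀ ι, (fun x => aleFluxField γ ρ p u ν ι x 0)
      = fun x => ρ x * (u x ι - ν x ι) := fun ι => by
    funext x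
    simp only [aleFluxField, eulerFluxField, stateField, Matrix.cons_val]
    ring
  have hmom : ∀ ι d : Fin 3, (fun x => aleFluxField γ ρ p u ν ι x d.succ.castSucc)
      = fun x => ρ x * (u x ι - ν x ι) * u x d + if ι = d then p x else 0 := fun ι d => by
    funext x
    fin_cases d <;> simp [aleFluxField, eulerFluxField, stateField] <;> ring
  have hkin : ∀ ι, (fun x => (u x ι - ν x ι) * (1 / 2 * ρ x * ∑ d, (u x d) ^ 2))
      = fun x => ρ x * (u x ι - ν x ι) * (1 / 2 * ∑ d, (u x d) ^ 2) := fun ι => by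
    funext x
    ring
  have hdmom : ∀ ι d : Fin 3, fderiv ℝ (fun x => aleFluxField γ ρ p u ν ι x d.succ.castSucc) x₀
        (Pi.single ι 1)
      = fderiv ℝ (fun x => ρ x * (u x ι - ν x ι) * u x d) x₀ (Pi.single ι 1)
        + if ι = d then fderiv ℝ p x₀ (Pi.single ι 1) else 0 := fun ι d => by
    rw [hmom, fderiv_add_ite_zero (hmu ι d) hp]
  rw [← Finset.sum_add_distrib]
  refine Finset.sum_congr rfl fun ι _ => ?_
  have hpress : ∑ d, u x₀ d * (if ι = d then fderiv ℝ p x₀ (Pi.single ι 1) else 0)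
      = fderiv ℝ p x₀ (Pi.single ι 1) * u x₀ ι := by
    simp [mul_comm]
  rw [hkin, fderiv_mul_half_sum_sq (hm ι) hu, ← hpress, add_assoc, ← Finset.sum_add_distrib]
  simp only [← mul_add, ← hdmom, ← hmass]
  rw [Fin.sum_univ_castSucc, Fin.sum_univ_succ]
  simp [Fin.sum_univ_three]

end
end

section
/- Entropy form of the ALE Euler flux divergence (the physical-space content of equation (2.28) of the paper). Fix γ > 1 and let ρ, p : ℝ³ → ℝ and u⃗, ν⃗ : ℝ³ → ℝ³ be differentiable at a point x₀ ∈ ℝ³, with ρ > 0 and p > 0 in a neighborhood of x₀. Define E := p/(γ−1) + ½ρ|u⃗|², the state U := (ρ, ρu₁, ρu₂, ρu₃, E), the Euler fluxes f_ι := (ρu_ι, ρu_ιu₁ + pδ_{ι1}, ρu_ιu₂ + pδ_{ι2}, ρu_ιu₃ + pδ_{ι3}, u_ι(E+p)), the ALE fluxes g_ι := f_ι − ν_ι·U, ς := log(p ρ^{−γ}), the entropy s := −ρς/(γ−1), the entropy fluxes f^s_ι := s·u_ι, and the entropy variables w := ((γ−ς)/(γ−1) − ρ|u⃗|²/(2p),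 ρu₁/p, ρu₂/p, ρu₃/p, −ρ/p). Then at x₀: w · Σ_{ι=1}^{3} ∂g_ι/∂x_ι = Σ_{ι=1}^{3} ∂(f^s_ι − ν_ι·s)/∂x_ι − ( Σ_{ι=1}^{3} ∂ν_ι/∂x_ι ) · ρ, where the partial derivatives act componentwise and the dot product is the Euclidean one in ℝ⁵. -/
noncomputable section

/-- mathematical entropy `s = −ρ ς/(γ−1)` with `ς = log(p ρ^{−γ})`, as a field on
`ℝ³`. -/
def entropyField (γ : ℝ) (ρ p : (Fin 3 → ℝ) → ℝ) (x : Fin 3 → ℝ) : ℝ :=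
  -(ρ x) * Real.log (p x * ρ x ^ (-γ)) / (γ - 1)

/-- entropy variables `w = ((γ−ς)/(γ−1) − ρ|u⃗|²/(2p), ρu₁/p, ρu₂/p, ρu₃/p, −ρ/p)` as
a field on `ℝ³`. -/
def entropyVarsField (γ : ℝ) (ρ p : (Fin 3 → ℝ) → ℝ) (u : (Fin 3 → ℝ) → Fin 3 → ℝ)
    (x : Fin 3 → ℝ) : Fin 5 → ℝ :=
  ![(γ - Real.log (p x * ρ x ^ (-γ))) / (γ - 1) - ρ x * (∑ d, (u x d) ^ 2) / (2 * p x),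
    ρ x * u x 0 / p x, ρ x * u x 1 / p x, ρ x * u x 2 / p x, -(ρ x) / p x]

/-- Leibniz rule for directional derivatives. -/
lemma fderiv_mul_dir {f g : (Fin 3 → ℝ) → ℝ} {x v : Fin 3 → ℝ}
    (hf : DifferentiableAt ℝ f x) (hg : DifferentiableAt ℝ g x) :
    fderiv ℝ (fun y => f y * g y) x v = fderiv ℝ f x v * g x + f x * fderiv ℝ g x v := by
  rw [fderiv_fun_mul hf hg]
  simp
  ring

lemma fderiv_sq_dir {f : (Fin 3 → ℝ) → ℝ} {x v : Fin 3 → ℝ} (hf : DifferentiableAt ℝ f x) :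
    fderiv ℝ (fun y => f y ^ 2) x v = 2 * f x * fderiv ℝ f x v := by
  simp only [pow_two]
  rw [fderiv_mul_dir hf hf]
  ring

lemma differentiableAt_totEnergy (γ : ℝ) {ρ p : (Fin 3 → ℝ) → ℝ} {u : (Fin 3 → ℝ) → Fin 3 → ℝ}
    {x : Fin 3 → ℝ} (hρ : DifferentiableAt ℝ ρ x) (hp : DifferentiableAt ℝ p x)
    (hu : ∀ d, DifferentiableAt ℝ (fun y => u y d) x) :
    DifferentiableAt ℝ (totEnergy γ ρ p u) x := by
  have h0 := hu 0
  have h1 := hu 1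
  have h2 := hu 2
  unfold totEnergy
  simp only [Fin.sum_univ_three]
  fun_prop

lemma fderiv_totEnergy (γ : ℝ) {ρ p : (Fin 3 → ℝ) → ℝ} {u : (Fin 3 → ℝ) → Fin 3 → ℝ}
    {x : Fin 3 → ℝ} (v : Fin 3 → ℝ) (hρ : DifferentiableAt ℝ ρ x) (hp : DifferentiableAt ℝ p x)
    (hu : ∀ d, DifferentiableAt ℝ (fun y => u y d) x) :
    fderiv ℝ (totEnergy γ ρ p u) x v = fderiv ℝ p x v / (γ - 1)
      + 1 / 2 * fderiv ℝ ρ x v * (∑ d, u x d ^ 2)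
      + ρ x * ∑ d, u x d * fderiv ℝ (fun y => u y d) x v := by
  have h0 := hu 0
  have h1 := hu 1
  have h2 := hu 2
  have hE : totEnergy γ ρ p u = fun y => (γ - 1)⁻¹ * p y
      + 1 / 2 * (ρ y * (u y 0 ^ 2 + u y 1 ^ 2 + u y 2 ^ 2)) := by
    funext y
    simp only [totEnergy, Fin.sum_univ_three]
    ring
  rw [hE, fderiv_fun_add (by fun_prop) (by fun_prop), fderiv_const_mul hp,
    fderiv_const_mul (by fun_prop)]
  simp only [add_apply, smul_apply, smul_eq_mul]
  rw [fderiv_mul_dir hρ (by fun_prop), fderiv_fun_add (by fun_prop) (by fun_prop),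
    fderiv_fun_add (by fun_prop) (by fun_prop)]
  simp only [add_apply, fderiv_sq_dir h0, fderiv_sq_dir h1,
    fderiv_sq_dir h2, Fin.sum_univ_three]
  ring

lemma hasFDerivAt_entropyField (γ : ℝ) {ρ p : (Fin 3 → ℝ) → ℝ} {x : Fin 3 → ℝ}
    (hρ : DifferentiableAt ℝ ρ x) (hp : DifferentiableAt ℝ p x) (hρx : 0 < ρ x) (hpx : 0 < p x) :
    HasFDerivAt (entropyField γ ρ p)
      ((γ - 1)⁻¹ • ((γ - Real.log (p x * ρ x ^ (-γ))) • fderiv ℝ ρ x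
        - (ρ x / p x) • fderiv ℝ p x)) x := by
  have hr : 0 < ρ x ^ (-γ) := Real.rpow_pos_of_pos hρx _
  have hlog := (hp.hasFDerivAt.mul
    (hρ.hasFDerivAt.rpow_const (p := -γ) (Or.inl hρx.ne'))).log (mul_pos hpx hr).ne'
  have h := (hρ.hasFDerivAt.neg.mul hlog).mul_const (γ - 1)⁻¹
  refine h.congr_fderiv ?_
  ext v
  have hpow : ρ x ^ (-γ - 1) = ρ x ^ (-γ) / ρ x := Real.rpow_sub_one hρx.ne' _
  simp [hpow]
  field_simp
  ring

/-- Entropy balance for a single flux component `ι`, differentiated in a direction `v`. -/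
lemma entropyVars_dot_fderiv_aleFlux {γ : ℝ} (hγ : 1 < γ)
    {ρ p : (Fin 3 → ℝ) → ℝ} {u ν : (Fin 3 → ℝ) → Fin 3 → ℝ} {x : Fin 3 → ℝ}
    (hρ : DifferentiableAt ℝ ρ x) (hp : DifferentiableAt ℝ p x)
    (hu : ∀ d, DifferentiableAt ℝ (fun y => u y d) x)
    (hν : ∀ d, DifferentiableAt ℝ (fun y => ν y d) x)
    (hρx : 0 < ρ x) (hpx : 0 < p x) (ι : Fin 3) (v : Fin 3 → ℝ) :
    ∑ c : Fin 5, entropyVarsField γ ρ p u x c *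
        fderiv ℝ (fun y => aleFluxField γ ρ p u ν ι y c) x v
      = fderiv ℝ (fun y => entropyField γ ρ p y * u y ι - ν y ι * entropyField γ ρ p y) x v
        - fderiv ℝ (fun y => ν y ι) x v * ρ x := by
  have hE := differentiableAt_totEnergy γ hρ hp hu
  have hs := hasFDerivAt_entropyField γ hρ hp hρx hpx
  have hsd := hs.differentiableAt
  have hui := hu ι
  have hνi := hν ι
  have hγ' : γ - 1 ≠ 0 := (sub_pos.2 hγ).ne'
  have mass : fderiv ℝ (fun y => aleFluxField γ ρ p u ν ι y 0) x v
      = fderiv ℝ ρ x v * (u x ι - ν x ι)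
        + ρ x * (fderiv ℝ (fun y => u y ι) x v - fderiv ℝ (fun y => ν y ι) x v) := by
    change fderiv ℝ (fun y => ρ y * u y ι - ν y ι * ρ y) x v = _
    rw [fderiv_fun_sub (by fun_prop) (by fun_prop), sub_apply,
      fderiv_mul_dir hρ hui, fderiv_mul_dir hνi hρ]
    ring
  have momentum (d : Fin 3) :
      fderiv ℝ (fun y => ρ y * u y ι * u y d + (if ι = d then p y else 0)
          - ν y ι * (ρ y * u y d)) x v
        = (fderiv ℝ ρ x v * (u x ι - ν x ι)
          + ρ x * (fderiv ℝ (fun y => u y ι) x v - fderiv ℝ (fun y => ν y ι) x v)) * u x d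
          + ρ x * (u x ι - ν x ι) * fderiv ℝ (fun y => u y d) x v
          + (if ι = d then fderiv ℝ p x v else 0) := by
    have hd := hu d
    have hif : DifferentiableAt ℝ (fun y => if ι = d then p y else 0) x := by
      split_ifs <;> fun_prop
    have hif' : fderiv ℝ (fun y => if ι = d then p y else 0) x v
        = if ι = d then fderiv ℝ p x v else 0 := by
      split_ifs <;> simp
    rw [fderiv_fun_sub (by fun_prop) (by fun_prop), sub_apply,
      fderiv_fun_add (by fun_prop) hif, add_apply, hif',
      fderiv_mul_dir (by fun_prop) hd, fderiv_mul_dir hρ hui,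
      fderiv_mul_dir hνi (by fun_prop), fderiv_mul_dir hρ hd]
    ring
  have energy : fderiv ℝ (fun y => aleFluxField γ ρ p u ν ι y 4) x v
      = fderiv ℝ (fun y => u y ι) x v * (totEnergy γ ρ p u x + p x)
        + u x ι * (fderiv ℝ (totEnergy γ ρ p u) x v + fderiv ℝ p x v)
        - (fderiv ℝ (fun y => ν y ι) x v * totEnergy γ ρ p u x
          + ν x ι * fderiv ℝ (totEnergy γ ρ p u) x v) := by
    change fderiv ℝ (fun y => u y ι * (totEnergy γ ρ p u y + p y)
      - ν y ι * totEnergy γ ρ p u y) x v = _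
    rw [fderiv_fun_sub (by fun_prop) (by fun_prop), sub_apply,
      fderiv_mul_dir hui (by fun_prop), fderiv_mul_dir hνi hE, fderiv_fun_add hE hp,
      add_apply]
  have entropy : fderiv ℝ (fun y => entropyField γ ρ p y * u y ι
        - ν y ι * entropyField γ ρ p y) x v
      = fderiv ℝ (entropyField γ ρ p) x v * (u x ι - ν x ι) + entropyField γ ρ p x *
        (fderiv ℝ (fun y => u y ι) x v - fderiv ℝ (fun y => ν y ι) x v) := by
    rw [fderiv_fun_sub (by fun_prop) (by fun_prop), sub_apply,
      fderiv_mul_dir hsd hui, fderiv_mul_dir hνi hsd]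
    ring
  have momentum_0 : fderiv ℝ (fun y => aleFluxField γ ρ p u ν ι y 1) x v = _ := momentum 0
  have momentum_1 : fderiv ℝ (fun y => aleFluxField γ ρ p u ν ι y 2) x v = _ := momentum 1
  have momentum_2 : fderiv ℝ (fun y => aleFluxField γ ρ p u ν ι y 3) x v = _ := momentum 2
  rw [Fin.sum_univ_five, mass, momentum_0, momentum_1, momentum_2, energy, entropy, hs.fderiv,
    fderiv_totEnergy γ v hρ hp hu]
  simp only [entropyVarsField, totEnergy, entropyField, Fin.sum_univ_three,
    smul_apply, sub_apply, smul_eq_mul,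
    Matrix.cons_val]
  generalize Real.log (p x * ρ x ^ (-γ)) = σ
  fin_cases ι <;> simp <;> field_simp <;> ring

/-- **Entropy form of the ALE Euler flux divergence** (the physical-space content of
equation (2.28)).  With the entropy fluxes `f^s_ι = s u_ι`, at every point where all
fields are differentiable and `ρ, p` are positive on a neighborhood:
`w·Σ_ι ∂g_ι/∂x_ι = Σ_ι ∂(f^s_ι − ν_ι s)/∂x_ι − (Σ_ι ∂ν_ι/∂x_ι)·ρ`. -/
theorem entropy_flux_divergence (γ : ℝ) (hγ : 1 < γ)
    (ρ p : (Fin 3 → ℝ) → ℝ) (u ν : (Fin 3 → ℝ) → Fin 3 → ℝ) (x₀ : Fin 3 → ℝ)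
    (hρ : DifferentiableAt ℝ ρ x₀) (hp : DifferentiableAt ℝ p x₀)
    (hu : ∀ d, DifferentiableAt ℝ (fun x => u x d) x₀)
    (hν : ∀ d, DifferentiableAt ℝ (fun x => ν x d) x₀)
    (hpos : ∀ᶠ x in nhds x₀, 0 < ρ x ∧ 0 < p x) :
    ∑ ι : Fin 3, ∑ c : Fin 5,
        entropyVarsField γ ρ p u x₀ c *
          fderiv ℝ (fun x => aleFluxField γ ρ p u ν ι x c) x₀ (Pi.single ι 1)
      = (∑ ι : Fin 3,
          fderiv ℝ (fun x => entropyField γ ρ p x * u x ι - ν x ι * entropyField γ ρ p x) x₀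
            (Pi.single ι 1))
        - (∑ ι : Fin 3, fderiv ℝ (fun x => ν x ι) x₀ (Pi.single ι 1)) * ρ x₀ := by
  obtain ⟨hρx, hpx⟩ := hpos.self_of_nhds
  rw [Finset.sum_mul, ← Finset.sum_sub_distrib]
  exact Finset.sum_congr rfl fun ι _ =>
    entropyVars_dot_fderiv_aleFlux hγ hρ hp hu hν hρx hpx ι _

end
end

section
/- Internal-energy surface identities for the Kennedy–Gruber (KG) and Kuya–Totani–Kawai (KTK) fluxes (the algebraic content of equations (3.25) and (3.26) of the paper). For every ι = 1,2,3: (i) for the KG flux, G_ι^{5,KG} − ½·\overline{|u⃗|}²·G_ι^{1,KG} − ⟨p⟩·u_ι⁻ = ⟨ρ⟩·⟨u_ι − ν_ι⟩·( ⟨e⟩ + Σ_{β=1}^{3}(⟨u_β²⟩ − ⟨u_β⟩²) ) + ½·⟨p⟩·⟦u_ι⟧; and (ii) for the KTK flux, G_ι^{5,KTK} − ½·\overline{|u⃗|}²·G_ι^{1,KTK} − ⟨p⟩·u_ι⁻ = ⟨ρ⟩·⟨u_ι − ν_ι⟩·⟨e⟩ + ½·p⁻·⟦u_ι⟧. In particular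 the interior pressure p⁻ (and not the pressure average ⟨p⟩) appears in the KTK identity. -/
noncomputable section

/-- oriented jump `⟦a⟧ = a⁺ − a⁻`. -/
def jumpI (am ap : ℝ) : ℝ := ap - am

/-- mass component (`ι`-direction) of both the Kennedy–Gruber (KG) and the
Kuya–Totani–Kawai (KTK) two-point fluxes: `⟨ρ⟩⟨u_ι − ν_ι⟩`. -/
def fluxMass (ρm ρp : ℝ) (um up νm νp : Fin 3 → ℝ) (ι : Fin 3) : ℝ :=
  avgI ρm ρp * avgI (um ι - νm ι) (up ι - νp ι)

/-- energy component of the Kennedy–Gruber (KG) flux: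
`G_ι^{5,KG} = ⟨ρ⟩⟨u_ι − ν_ι⟩(⟨e⟩ + ½⟨|u⃗|²⟩) + ⟨p⟩⟨u_ι⟩`, with `e± = p±/((γ−1)ρ±)`. -/
def fluxEnergyKG (γ ρm ρp : ℝ) (um up νm νp : Fin 3 → ℝ) (pm pp : ℝ) (ι : Fin 3) : ℝ :=
  fluxMass ρm ρp um up νm νp ι *
      (avgI (pm / ((γ - 1) * ρm)) (pp / ((γ - 1) * ρp))
        + 1 / 2 * avgI (∑ d, (um d) ^ 2) (∑ d, (up d) ^ 2))
    + avgI pm pp * avgI (um ι) (up ι)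

/-- energy component of the Kuya–Totani–Kawai (KTK) flux:
`G_ι^{5,KTK} = ⟨ρ⟩⟨u_ι − ν_ι⟩(⟨e⟩ + ½\overline{|u⃗|}²) + 2⟨p⟩⟨u_ι⟩ − ⟨p u_ι⟩`. -/
def fluxEnergyKTK (γ ρm ρp : ℝ) (um up νm νp : Fin 3 → ℝ) (pm pp : ℝ) (ι : Fin 3) : ℝ :=
  fluxMass ρm ρp um up νm νp ι *
      (avgI (pm / ((γ - 1) * ρm)) (pp / ((γ - 1) * ρp)) + 1 / 2 * uBarSq um up)
    + 2 * avgI pm pp * avgI (um ι) (up ι) - avgI (pm * um ι) (pp * up ι)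

/-- **Internal-energy surface identities for the KG and KTK fluxes** (the algebraic
content of equations (3.25) and (3.26)).  For interface states `(ρ⁻,u⃗⁻,p⁻)`,
`(ρ⁺,u⃗⁺,p⁺)` with positive densities and pressures and grid velocities `ν⃗±`:
(i) `G_ι^{5,KG} − ½\overline{|u⃗|}² G_ι^{1,KG} − ⟨p⟩u_ι⁻
     = ⟨ρ⟩⟨u_ι − ν_ι⟩(⟨e⟩ + Σ_β(⟨u_β²⟩ − ⟨u_β⟩²)) + ½⟨p⟩⟦u_ι⟧`,
(ii) `G_ι^{5,KTK} − ½\overline{|u⃗|}² G_ι^{1,KTK} − ⟨p⟩u_ι⁻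
     = ⟨ρ⟩⟨u_ι − ν_ι⟩⟨e⟩ + ½ p⁻ ⟦u_ι⟧`;
in particular the interior pressure `p⁻` (not `⟨p⟩`) appears in the KTK identity. -/
theorem internal_energy_surface_identities_KG_KTK (γ : ℝ) (hγ : 1 < γ)
    (ρm ρp pm pp : ℝ) (um up νm νp : Fin 3 → ℝ)
    (hρm : 0 < ρm) (hρp : 0 < ρp) (hpm : 0 < pm) (hpp : 0 < pp) :
    ∀ ι : Fin 3,
      (fluxEnergyKG γ ρm ρp um up νm νp pm pp ι
          - 1 / 2 * uBarSq um up * fluxMass ρm ρp um up νm νp ι - avgI pm pp * um ι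
        = avgI ρm ρp * avgI (um ι - νm ι) (up ι - νp ι) *
            (avgI (pm / ((γ - 1) * ρm)) (pp / ((γ - 1) * ρp))
              + ∑ β, (avgI ((um β) ^ 2) ((up β) ^ 2) - avgI (um β) (up β) ^ 2))
          + 1 / 2 * avgI pm pp * jumpI (um ι) (up ι))
      ∧ (fluxEnergyKTK γ ρm ρp um up νm νp pm pp ι
          - 1 / 2 * uBarSq um up * fluxMass ρm ρp um up νm νp ι - avgI pm pp * um ι
        = avgI ρm ρp * avgI (um ι - νm ι) (up ι - νp ι) *
            avgI (pm / ((γ - 1) * ρm)) (pp / ((γ - 1) * ρp))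
          + 1 / 2 * pm * jumpI (um ι) (up ι)) := by
  intro ι
  constructor
  · simp only [fluxEnergyKG, fluxMass, uBarSq, avgI, jumpI, Fin.sum_univ_three]
    ring
  · simp only [fluxEnergyKTK, fluxMass, avgI, jumpI]
    ring
end
end
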